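/- arXiv:2503.01331 — 2 statements merged into one kernel-verified Lean document; each statement's English description precedes it below -/
import Mathlib

section
/- Let 𝒜 be a unital C*-algebra and let a ∈ 𝒜. Let φ, ψ : [0,∞) → [0,∞) be continuous functions with φ(t)·ψ(t) = t for every t ≥ 0. Then for every state f on 𝒜, |f(a)|² ≤ f(φ(|a|)²)·f(ψ(|a*|)²), where |a| = (a*a)^{1/2}, |a*| = (aa*)^{1/2}, and φ(|a|), ψ(|a*|) are defined via continuous functional calculus. -/
/-- A state on a unital C*-algebra `A`: a continuous linear functional `f : A → ℂ`
with `f 1 = 1` and `‖f‖ = 1`. -/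
def IsState {A : Type*} [CStarAlgebra A] (f : A →L[ℂ] ℂ) : Prop :=
  f 1 = 1 ∧ ‖f‖ = 1

/-- `‖a‖_σ := sup_{f ∈ S(A)} √(σ(|f(a)|², f(a*a)))`, where `f(a*a)` is the (nonnegative)
real number `(f (star a * a)).re`. -/
noncomputable def sigmaNorm {A : Type*} [CStarAlgebra A] (σ : ℝ → ℝ → ℝ) (a : A) : ℝ :=
  sSup {x : ℝ | ∃ f : A →L[ℂ] ℂ, IsState f ∧
    x = Real.sqrt (σ (‖f a‖ ^ 2) (f (star a * a)).re)}

/-- The algebraic numerical radius `v(a) := sup_{f ∈ S(A)} |f(a)|`. -/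
noncomputable def numRadius {A : Type*} [CStarAlgebra A] (a : A) : ℝ :=
  sSup {x : ℝ | ∃ f : A →L[ℂ] ℂ, IsState f ∧ x = ‖f a‖}

/-- The Crawford number `m(a) := inf_{f ∈ S(A)} |f(a)|`. -/
noncomputable def crawford {A : Type*} [CStarAlgebra A] (a : A) : ℝ :=
  sInf {x : ℝ | ∃ f : A →L[ℂ] ℂ, IsState f ∧ x = ‖f a‖}

/-- `‖a‖_∇ := sup_{f ∈ S(A)} √((|f(a)|² + f(a*a))/2)`. -/
noncomputable def nablaNorm {A : Type*} [CStarAlgebra A] (a : A) : ℝ :=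
  sSup {x : ℝ | ∃ f : A →L[ℂ] ℂ, IsState f ∧
    x = Real.sqrt ((‖f a‖ ^ 2 + (f (star a * a)).re) / 2)}

open Polynomial in
theorem SemiconjBy.aeval_right {R A : Type*} [CommSemiring R] [Semiring A] [Algebra R A]
    {a x y : A} (h : SemiconjBy a x y) (p : R[X]) :
    SemiconjBy a (aeval x p) (aeval y p) := by
  induction p using Polynomial.induction_on' with
  | add p q hp hq => simpa using hp.add_right hq
  | monomial n r =>
    simp only [aeval_monomial]
    exact SemiconjBy.mul_right (Algebra.commutes r a).symm (h.pow_right n)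

section CStar

open scoped ComplexOrder

variable {A : Type*} [CStarAlgebra A]

/-- The continuous functional calculus is approximated by polynomials in the element. -/
theorem exists_norm_cfc_sub_aeval_le {g : ℝ → ℝ} {M : ℝ} (hg : ContinuousOn g (Set.Icc 0 M))
    {ε : ℝ} (hε : 0 < ε) :
    ∃ p : Polynomial ℝ, ∀ x : A, IsSelfAdjoint x → spectrum ℝ x ⊆ Set.Icc 0 M →
      ‖cfc g x - Polynomial.aeval x p‖ ≤ ε := by
  obtain ⟨p, hp⟩ := exists_polynomial_near_of_continuousOn 0 M g hg ε hε
  refine ⟨p, fun x hx hxM ↦ ?_⟩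
  have hgx := hg.mono hxM
  rw [← cfc_polynomial p x, ← cfc_sub g p.eval x]
  refine norm_cfc_le hε.le fun t ht ↦ ?_
  rw [Real.norm_eq_abs, abs_sub_comm]
  exact (hp t (hxM ht)).le

/-- A continuous linear functional with `f 1 = 1` and `‖f‖ = 1` satisfies `|f x - c| ≤ ‖x - c‖`. -/
theorem IsState.norm_apply_sub_le {f : A →L[ℂ] ℂ} (hf : IsState f) (x : A) (c : ℂ) :
    ‖f x - c‖ ≤ ‖x - algebraMap ℂ A c‖ := by
  have h := f.le_opNorm (x - algebraMap ℂ A c)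
  simpa [Algebra.algebraMap_eq_smul_one, hf.1, hf.2] using h

theorem IsState.im_apply_eq_zero {f : A →L[ℂ] ℂ} (hf : IsState f) {x : A}
    (hx : IsSelfAdjoint x) : (f x).im = 0 := by
  have key (t : ℝ) : ((f x).im - t) ^ 2 ≤ ‖x‖ ^ 2 + t ^ 2 := by
    have h1 := (Complex.abs_im_le_norm _).trans (hf.norm_apply_sub_le x (t * Complex.I))
    have h2 : ‖x - algebraMap ℂ A (t * Complex.I)‖ ^ 2 ≤ ‖x‖ ^ 2 + t ^ 2 := by
      rw [sq, ← CStarRing.norm_star_mul_self]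
      have : star (x - algebraMap ℂ A (t * Complex.I)) * (x - algebraMap ℂ A (t * Complex.I))
          = x * x + algebraMap ℂ A (t ^ 2) := by
        have e : star (algebraMap ℂ A (t * Complex.I)) = - algebraMap ℂ A (t * Complex.I) := by
          rw [← algebraMap_star_comm, ← map_neg]
          simp
        have e2 : algebraMap ℂ A (t * Complex.I) * algebraMap ℂ A (t * Complex.I)
            = - algebraMap ℂ A (t ^ 2) := by
          rw [← map_mul, ← map_neg]
          congr 1
          linear_combination (t : ℂ) ^ 2 * Complex.I_sq
        have e3 := Algebra.commutes (t * Complex.I : ℂ) x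
        rw [star_sub, hx.star_eq, e]
        simp only [sub_neg_eq_add, add_mul, mul_sub, e2, e3]
        abel
      rw [this]
      refine (norm_add_le _ _).trans (add_le_add ?_ ?_)
      · exact (norm_mul_le _ _).trans_eq (sq _).symm
      · rcases subsingleton_or_nontrivial A with _ | _
        · rw [Subsingleton.elim (algebraMap ℂ A (t ^ 2)) 0, norm_zero]
          positivity
        · rw [norm_algebraMap']
          simp
    have h3 : |(f x).im - t| ≤ ‖x - algebraMap ℂ A (t * Complex.I)‖ := by simpa using h1
    calc ((f x).im - t) ^ 2 = |(f x).im - t| ^ 2 := (sq_abs _).symm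
      _ ≤ _ := pow_le_pow_left₀ (abs_nonneg _) h3 2
      _ ≤ _ := h2
  by_contra hne
  have h := key (-(‖x‖ ^ 2 + 1) / (2 * (f x).im))
  have : (f x).im * (-(‖x‖ ^ 2 + 1) / (2 * (f x).im)) = -(‖x‖ ^ 2 + 1) / 2 := by
    field_simp
  nlinarith [sq_nonneg (f x).im]

variable [PartialOrder A] [StarOrderedRing A]

theorem IsState.apply_nonneg {f : A →L[ℂ] ℂ} (hf : IsState f) {x : A} (hx : 0 ≤ x) :
    0 ≤ f x := by
  rw [Complex.nonneg_iff]
  refine ⟨?_, (hf.im_apply_eq_zero (.of_nonneg hx)).symm⟩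
  have h1 : ‖x - algebraMap ℂ A (‖x‖ : ℂ)‖ ≤ ‖x‖ := by
    have e : x - algebraMap ℂ A (‖x‖ : ℂ) = cfc (fun t : ℝ ↦ t - ‖x‖) x := by
      rw [cfc_sub (fun t : ℝ ↦ t) (fun _ ↦ ‖x‖) x, cfc_id' ℝ x, cfc_const ‖x‖ x,
        IsScalarTower.algebraMap_apply ℝ ℂ A]
      rfl
    rw [e]
    refine norm_cfc_le (norm_nonneg _) fun t ht ↦ ?_
    rcases subsingleton_or_nontrivial A with _ | _
    · simp [spectrum.of_subsingleton] at ht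
    have ht0 := spectrum_nonneg_of_nonneg hx ht
    have ht1 := spectrum.norm_le_norm_of_mem ht
    rw [Real.norm_eq_abs] at ht1 ⊢
    rw [abs_le]
    constructor <;> linarith [le_abs_self t]
  have h2 := (Complex.abs_re_le_norm _).trans ((hf.norm_apply_sub_le x ‖x‖).trans h1)
  have h3 := (abs_le.mp h2).1
  simp at h3
  linarith

/-- The positive linear functional underlying a state. -/
noncomputable def IsState.toPositiveLinearMap {f : A →L[ℂ] ℂ} (hf : IsState f) : A →ₚ[ℂ] ℂ :=
  .mk₀ f.toLinearMap fun _ hx ↦ hf.apply_nonneg hx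

/-- The Cauchy-Schwarz inequality for states. -/
theorem IsState.norm_apply_star_mul_sq_le {f : A →L[ℂ] ℂ} (hf : IsState f) (x y : A) :
    ‖f (star x * y)‖ ^ 2 ≤ (f (star x * x)).re * (f (star y * y)).re := by
  let F := hf.toPositiveLinearMap
  have h := inner_mul_inner_self_le (𝕜 := ℂ) (F.toPreGNS x) (F.toPreGNS y)
  rw [norm_inner_symm (F.toPreGNS y), ← sq] at h
  exact h

theorem IsState.re_apply_mono {f : A →L[ℂ] ℂ} (hf : IsState f) {x y : A} (hxy : x ≤ y) :
    (f x).re ≤ (f y).re := by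
  have h := (Complex.nonneg_iff.mp (hf.apply_nonneg (sub_nonneg.mpr hxy))).1
  simpa using h

/-- An element intertwining two positive elements intertwines their functional calculi. -/
theorem SemiconjBy.cfc_right_of_nonneg {a x y : A} (h : SemiconjBy a x y) (hx : 0 ≤ x)
    (hy : 0 ≤ y) {g : ℝ → ℝ} (hg : ContinuousOn g (Set.Ici 0)) :
    SemiconjBy a (cfc g x) (cfc g y) := by
  rcases subsingleton_or_nontrivial A with _ | _
  · exact Subsingleton.elim _ _
  set M := max ‖x‖ ‖y‖
  have hspec (z : A) (hz : 0 ≤ z) (hzM : ‖z‖ ≤ M) : spectrum ℝ z ⊆ Set.Icc 0 M := fun t ht ↦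
    ⟨spectrum_nonneg_of_nonneg hz ht,
      (le_abs_self t).trans ((spectrum.norm_le_norm_of_mem ht).trans hzM)⟩
  rw [SemiconjBy, ← sub_eq_zero, ← norm_le_zero_iff]
  have key (ε : ℝ) (hε : 0 < ε) : ‖a * cfc g x - cfc g y * a‖ ≤ ε * (2 * ‖a‖) := by
    obtain ⟨p, hp⟩ := exists_norm_cfc_sub_aeval_le (A := A) (M := M)
      (hg.mono Set.Icc_subset_Ici_self) hε
    have h1 := hp x (.of_nonneg hx) (hspec x hx (le_max_left _ _))
    have h2 := hp y (.of_nonneg hy) (hspec y hy (le_max_right _ _))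
    have e : a * cfc g x - cfc g y * a
        = a * (cfc g x - Polynomial.aeval x p) - (cfc g y - Polynomial.aeval y p) * a := by
      rw [mul_sub, sub_mul, (h.aeval_right p).eq]
      abel
    rw [e]
    calc _ ≤ ‖a‖ * ε + ε * ‖a‖ := (norm_sub_le _ _).trans (add_le_add
            ((norm_mul_le _ _).trans (by gcongr)) ((norm_mul_le _ _).trans (by gcongr)))
      _ = _ := by ring
  have hlim : Filter.Tendsto (fun ε : ℝ ↦ ε * (2 * ‖a‖)) (nhdsWithin 0 (Set.Ioi 0)) (nhds 0) :=
    (Continuous.tendsto' (by fun_prop) 0 0 (by simp)).mono_left nhdsWithin_le_nhds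
  exact ge_of_tendsto hlim (Filter.eventually_of_mem self_mem_nhdsWithin key)

theorem CFC.semiconjBy_sqrt_star_mul_self (a : A) :
    SemiconjBy a (CFC.sqrt (star a * a)) (CFC.sqrt (a * star a)) := by
  rw [CFC.sqrt_eq_real_sqrt (star a * a), CFC.sqrt_eq_real_sqrt (a * star a),
    cfcₙ_eq_cfc, cfcₙ_eq_cfc]
  exact SemiconjBy.cfc_right_of_nonneg (mul_assoc _ _ _).symm (star_mul_self_nonneg a)
    (mul_star_self_nonneg a) Real.continuous_sqrt.continuousOn

/-- `(a h(|a|))* (a h(|a|)) = (|a| h(|a|))²`. -/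
theorem CFC.star_mul_self_mul_cfc_sqrt (a : A) {h : ℝ → ℝ} (hh : ContinuousOn h (Set.Ici 0)) :
    star (a * cfc h (CFC.sqrt (star a * a))) * (a * cfc h (CFC.sqrt (star a * a)))
      = cfc (fun t ↦ (t * h t) ^ 2) (CFC.sqrt (star a * a)) := by
  set p := CFC.sqrt (star a * a) with hp
  have hp0 : 0 ≤ p := CFC.sqrt_nonneg _
  have hhp : ContinuousOn h (spectrum ℝ p) :=
    hh.mono fun t ht ↦ spectrum_nonneg_of_nonneg hp0 ht
  have hpp : p * p = star a * a := CFC.sqrt_mul_sqrt_self _ (star_mul_self_nonneg a)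
  have hs : star (cfc h p) = cfc h p := (cfc_predicate h p : IsSelfAdjoint _).star_eq
  have e : cfc (fun t ↦ (t * h t) ^ 2) p = cfc (fun t ↦ h t * (t * (t * h t))) p := by
    congr! 2 with t
    ring
  rw [e, cfc_mul h (fun t ↦ t * (t * h t)) p, cfc_mul (fun t ↦ t) (fun t ↦ t * h t) p,
    cfc_mul (fun t ↦ t) h p, cfc_id' ℝ p, star_mul, hs, ← mul_assoc p p, hpp]
  simp only [mul_assoc]

end CStar

/-- If `φ, ψ : [0,∞) → [0,∞)` are continuous with `φ(t)ψ(t) = t`, then for every state `f`,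
`|f(a)|² ≤ f(φ(|a|)²) f(ψ(|a*|)²)`. -/
theorem abs_state_sq_le {A : Type*} [CStarAlgebra A] [PartialOrder A] [StarOrderedRing A]
    (a : A) (φ ψ : ℝ → ℝ) (hφc : ContinuousOn φ (Set.Ici 0)) (hψc : ContinuousOn ψ (Set.Ici 0))
    (hφ0 : ∀ t, 0 ≤ t → 0 ≤ φ t) (hψ0 : ∀ t, 0 ≤ t → 0 ≤ ψ t)
    (hφψ : ∀ t, 0 ≤ t → φ t * ψ t = t)
    (f : A →L[ℂ] ℂ) (hf : IsState f) :
    ‖f a‖ ^ 2 ≤ (f ((cfc φ (CFC.sqrt (star a * a))) ^ 2)).re *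
      (f ((cfc ψ (CFC.sqrt (a * star a))) ^ 2)).re := by

  have hsemi := CFC.semiconjBy_sqrt_star_mul_self a
  have hkey {h : ℝ → ℝ} (hh : ContinuousOn h (Set.Ici 0)) :=
    CFC.star_mul_self_mul_cfc_sqrt a hh
  have hp0 : 0 ≤ CFC.sqrt (star a * a) := CFC.sqrt_nonneg _
  have hq0 : 0 ≤ CFC.sqrt (a * star a) := CFC.sqrt_nonneg _
  set p := CFC.sqrt (star a * a)
  set q := CFC.sqrt (a * star a)
  have hpsa : IsSelfAdjoint p := .of_nonneg hp0
  have hpos {t : ℝ} (ht : t ∈ spectrum ℝ p) : 0 ≤ t := spectrum_nonneg_of_nonneg hp0 ht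
  have hψq : star (cfc ψ q) = cfc ψ q := (cfc_predicate ψ q : IsSelfAdjoint _).star_eq
  have hφp : star (cfc φ p) = cfc φ p := (cfc_predicate φ p : IsSelfAdjoint _).star_eq
  have hX : 0 ≤ (f (cfc φ p ^ 2)).re := by
    simpa [sq, hφp] using hf.re_apply_mono (star_mul_self_nonneg (cfc φ p))
  have hY : 0 ≤ (f (cfc ψ q ^ 2)).re := by
    simpa [sq, hψq] using hf.re_apply_mono (star_mul_self_nonneg (cfc ψ q))
  rw [← Real.le_sqrt (norm_nonneg _) (mul_nonneg hX hY)]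
  refine le_of_forall_pos_le_add fun ε hε ↦ ?_
  have hden : ContinuousOn (fun t : ℝ ↦ t + ε) (Set.Ici 0) := by fun_prop
  have hh : ContinuousOn (fun t ↦ φ t / (t + ε)) (Set.Ici 0) :=
    hφc.div hden fun t ht ↦ (add_pos_of_nonneg_of_pos ht hε).ne'
  have hk : ContinuousOn (fun t ↦ 1 - ψ t * (φ t / (t + ε))) (Set.Ici 0) :=
    continuousOn_const.sub (hψc.mul hh)
  set b := a * cfc (fun t ↦ φ t / (t + ε)) p with hb
  have hψp' : ContinuousOn ψ (spectrum ℝ p) := hψc.mono fun _ ↦ hpos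
  have hφp' : ContinuousOn φ (spectrum ℝ p) := hφc.mono fun _ ↦ hpos
  have hhp' : ContinuousOn (fun t ↦ φ t / (t + ε)) (spectrum ℝ p) := hh.mono fun _ ↦ hpos
  have hbb : star b * b ≤ cfc φ p ^ 2 := by
    rw [hb, hkey hh, ← cfc_pow φ 2 p hφp' hpsa]
    refine cfc_mono (fun t ht ↦ ?_) ((continuousOn_id.mul hhp').pow 2) (hφp'.pow 2)
    have ht0 := hpos ht
    have hφt := hφ0 t ht0
    have : t * (φ t / (t + ε)) ≤ φ t := by
      rw [mul_div_assoc', div_le_iff₀ (by positivity)]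
      nlinarith
    exact pow_le_pow_left₀ (by positivity) this 2
  have hdiff : a - cfc ψ q * b = a * cfc (fun t ↦ 1 - ψ t * (φ t / (t + ε))) p := by
    rw [cfc_sub (fun _ ↦ 1) (fun t ↦ ψ t * (φ t / (t + ε))) p continuousOn_const
        (hψp'.mul hhp'), cfc_const_one ℝ p hpsa,
      cfc_mul ψ (fun t ↦ φ t / (t + ε)) p hψp' hhp', mul_sub, mul_one, hb, ← mul_assoc, ← mul_assoc,
      (hsemi.cfc_right_of_nonneg hp0 hq0 hψc).eq]
  have hnorm : ‖a - cfc ψ q * b‖ ≤ ε := by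
    rw [← sq_le_sq₀ (norm_nonneg _) hε.le, sq, ← CStarRing.norm_star_mul_self, hdiff, hkey hk]
    refine norm_cfc_le (by positivity) fun t ht ↦ ?_
    have ht0 := hpos ht
    have e : t * (1 - ψ t * (φ t / (t + ε))) = t * ε / (t + ε) := by
      have : ψ t * (φ t / (t + ε)) = t / (t + ε) := by
        rw [mul_div_assoc', mul_comm, hφψ t ht0]
      rw [this]
      field_simp
      ring
    rw [e, norm_pow, Real.norm_of_nonneg (by positivity)]
    refine pow_le_pow_left₀ (by positivity) ?_ 2
    rw [div_le_iff₀ (by positivity)]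
    nlinarith
  have hcs : ‖f (cfc ψ q * b)‖ ≤ √((f (cfc φ p ^ 2)).re * (f (cfc ψ q ^ 2)).re) := by
    refine Real.le_sqrt_of_sq_le ?_
    have h := hf.norm_apply_star_mul_sq_le (cfc ψ q) b
    rw [hψq, ← sq] at h
    refine h.trans ?_
    rw [mul_comm]
    exact mul_le_mul_of_nonneg_right (hf.re_apply_mono hbb) hY
  calc ‖f a‖ = ‖f (cfc ψ q * b) + f (a - cfc ψ q * b)‖ := by simp
    _ ≤ ‖f (cfc ψ q * b)‖ + ‖f (a - cfc ψ q * b)‖ := norm_add_le _ _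
    _ ≤ _ := add_le_add hcs
      ((f.le_opNorm _).trans (by rw [hf.2, one_mul]; exact hnorm))
end

section
/- Let 𝒜 be a unital C*-algebra and let σ : ℝ → ℝ → ℝ be monotone in each argument on nonnegative reals and satisfy σ(x,y) ≤ (x+y)/2 for all x, y ≥ 0. Then for every a ∈ 𝒜 and every α with 0 ≤ α ≤ 1, ‖a‖_σ² ≤ (1/2)·‖ (1+α)·(a*a) + (1−α)·(aa*) ‖. -/
namespace IsState

variable {A : Type*} [CStarAlgebra A] {f : A →L[ℂ] ℂ}

theorem norm_apply_le (hf : IsState f) (x : A) : ‖f x‖ ≤ ‖x‖ := by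
  simpa [hf.2] using f.le_opNorm x

theorem nontrivial (hf : IsState f) : Nontrivial A := by
  refine ⟨⟨0, 1, fun h => ?_⟩⟩
  have h1 := hf.1
  rw [← h, map_zero] at h1
  exact zero_ne_one h1

/-- A state is real-valued on selfadjoint elements. -/
theorem im_apply_eq_zero_s16 (hf : IsState f) {h : A} (hh : IsSelfAdjoint h) : (f h).im = 0 := by
  have := hf.nontrivial
  have key : ∀ t : ℝ, ((f h).im + t) ^ 2 ≤ ‖h‖ ^ 2 + t ^ 2 := by
    intro t
    set z : A := h + (Complex.I * t) • (1 : A) with hz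
    have hfz : f z = f h + Complex.I * t := by simp [hz, hf.1]
    have him : ((f h).im + t) ^ 2 ≤ ‖f z‖ ^ 2 := by
      rw [← sq_abs ((f h).im + t)]
      have : (f h).im + t = (f z).im := by simp [hfz]
      rw [this]
      gcongr
      exact Complex.abs_im_le_norm _
    have hzz : star z * z = h * h + ((t : ℂ) ^ 2) • (1 : A) := by
      have hc : star (Complex.I * t) = -(Complex.I * t) := by simp
      have hI : (t : ℂ) ^ 2 = -((Complex.I * t) * (Complex.I * t)) := by
        linear_combination (t : ℂ) ^ 2 * Complex.I_mul_I
      rw [hz, star_add, star_smul, hh.star_eq, star_one, hc, hI]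
      simp only [add_mul, mul_add, neg_smul, neg_mul, smul_mul_assoc, mul_smul_comm, one_mul,
        mul_one]
      module
    have hnorm : ‖z‖ ^ 2 ≤ ‖h‖ ^ 2 + t ^ 2 := by
      rw [pow_two ‖z‖, ← CStarRing.norm_star_mul_self, hzz]
      refine (norm_add_le _ _).trans ?_
      rw [norm_smul, norm_one, pow_two ‖h‖]
      gcongr
      · exact norm_mul_le _ _
      · simp
    have := hf.norm_apply_le z
    have : ‖f z‖ ^ 2 ≤ ‖z‖ ^ 2 := by gcongr
    linarith
  by_contra hb
  have h1 := key ((‖h‖ ^ 2 + 1) / (2 * (f h).im))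
  have h2 : 2 * (f h).im * ((‖h‖ ^ 2 + 1) / (2 * (f h).im)) = ‖h‖ ^ 2 + 1 := by field_simp
  nlinarith [sq_nonneg (f h).im]

theorem apply_star (hf : IsState f) (a : A) : f (star a) = star (f a) := by
  have h1 := hf.im_apply_eq_zero_s16 (IsSelfAdjoint.add_star_self a)
  have h2 := hf.im_apply_eq_zero_s16 (h := Complex.I • (a - star a)) (by
    rw [isSelfAdjoint_iff, star_smul, star_sub, star_star]
    simp [smul_sub, neg_add_eq_sub])
  simp at h1 h2
  apply Complex.ext <;> simp <;> linarith

/-- A state is positive. -/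
theorem re_apply_star_mul_self_nonneg (hf : IsState f) (a : A) : 0 ≤ (f (star a * a)).re := by
  let _ := CStarAlgebra.spectralOrder A
  have := CStarAlgebra.spectralOrderedRing A
  set p := star a * a with hp
  have hp0 : 0 ≤ p := star_mul_self_nonneg a
  have hle : p ≤ algebraMap ℝ A ‖p‖ := (IsSelfAdjoint.of_nonneg hp0).le_algebraMap_norm_self
  have hn : ‖algebraMap ℝ A ‖p‖ - p‖ ≤ ‖p‖ := by
    rw [CStarAlgebra.norm_le_iff_le_algebraMap _ (norm_nonneg p) (sub_nonneg.2 hle)]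
    exact sub_le_self _ hp0
  have hfp := (Complex.re_le_norm _).trans ((hf.norm_apply_le _).trans hn)
  have : algebraMap ℝ A ‖p‖ = (‖p‖ : ℂ) • (1 : A) := by
    rw [Algebra.algebraMap_eq_smul_one]; simp
  rw [map_sub, this, map_smul, hf.1] at hfp
  simp at hfp
  exact hfp

/-- The Cauchy–Schwarz inequality for states. -/
theorem norm_apply_sq_le (hf : IsState f) (a : A) : ‖f a‖ ^ 2 ≤ (f (star a * a)).re := by
  have h := hf.re_apply_star_mul_self_nonneg (a - f a • 1)
  have e : star (a - f a • (1 : A)) * (a - f a • 1) =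
      star a * a - f a • star a - star (f a) • a + (star (f a) * f a) • (1 : A) := by
    simp only [star_sub, star_smul, star_one, sub_mul, mul_sub, smul_mul_assoc, mul_smul_comm,
      one_mul, mul_one]
    module
  rw [e] at h
  simp only [map_add, map_sub, map_smul, hf.apply_star, hf.1, smul_eq_mul] at h
  rw [Complex.sq_norm, Complex.normSq_apply]
  simp at h
  linarith

end IsState

/-- If `σ ≤ ∇` and is monotone in each argument on nonnegative reals, then for `0 ≤ α ≤ 1`,
`‖a‖_σ² ≤ (1/2)‖(1+α)(a*a) + (1-α)(aa*)‖`. -/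
theorem sigmaNorm_sq_le_alpha {A : Type*} [CStarAlgebra A] (σ : ℝ → ℝ → ℝ)
    (hσmono : ∀ x x' y y' : ℝ, 0 ≤ x → x ≤ x' → 0 ≤ y → y ≤ y' → σ x y ≤ σ x' y')
    (hσle : ∀ x y : ℝ, 0 ≤ x → 0 ≤ y → σ x y ≤ (x + y) / 2)
    (a : A) (α : ℝ) (hα0 : 0 ≤ α) (hα1 : α ≤ 1) :
    sigmaNorm σ a ^ 2 ≤
      (1 / 2) * ‖(1 + α) • (star a * a) + (1 - α) • (a * star a)‖ := by
  set b := (1 + α) • (star a * a) + (1 - α) • (a * star a) with hb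
  have hnonneg : 0 ≤ sigmaNorm σ a :=
    Real.sSup_nonneg (by rintro x ⟨f, -, rfl⟩; exact Real.sqrt_nonneg _)
  rw [← Real.le_sqrt hnonneg (by positivity)]
  refine Real.sSup_le ?_ (Real.sqrt_nonneg _)
  rintro x ⟨f, hf, rfl⟩
  refine Real.sqrt_le_sqrt ?_
  have h1 := hf.norm_apply_sq_le a
  have h2 : ‖f a‖ ^ 2 ≤ (f (a * star a)).re := by
    simpa [hf.apply_star] using hf.norm_apply_sq_le (star a)
  refine (hσle _ _ (sq_nonneg _) ((sq_nonneg _).trans h1)).trans ?_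
  have h3 := (Complex.re_le_norm _).trans (hf.norm_apply_le b)
  have h4 : (f b).re = (1 + α) * (f (star a * a)).re + (1 - α) * (f (a * star a)).re := by
    simp [hb, ← Complex.coe_smul]
  nlinarith [mul_le_mul_of_nonneg_left h1 hα0, mul_le_mul_of_nonneg_left h2 (sub_nonneg.2 hα1)]
end
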